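/- Fix α > 1/2 and δ ∈ (−1, 0). For a positive integer n set N = ⌊n^{1+α}⌋, A = √(4(1+δ)α (log n)/n), and B = A·n² + Φ^{-1}(1 − A·n²/N)·n (well-defined since A·n²/N ∈ (0,1) for n large), and define the truncated likelihood ratio L'_π = (1/|S|) · Σ_{S ∈ S} exp(A·X_S − A²n²/2) · 1{ X_S ≤ B }. Then there exist an absolute constant C < ∞ and a threshold n₁(α, δ) < ∞ such that for all n ≥ n₁(α, δ): E₀(L'_π) = 1 − A·n²/N and Var₀(L'_π) ≤ C · A² · n⁴ / N². -/

import Mathlib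

open MeasureTheory ProbabilityTheory Real Filter Topology

noncomputable section

/-- Law of the N×N Gaussian observation matrix with mean matrix θ and unit variances. -/
def PTheta (N : ℕ) (θ : Fin N → Fin N → ℝ) : Measure (Fin N → Fin N → ℝ) :=
  Measure.pi fun i => Measure.pi fun j => gaussianReal (θ i j) 1

/-- Parameter space Θ(A, n, N). -/
def ThetaSet (A : ℝ) (n N : ℕ) : Set (Fin N → Fin N → ℝ) :=
  {θ | ∃ R C : Finset (Fin N), R.card = n ∧ C.card = n ∧
    (∀ i j, i ∈ R → j ∈ C → A ≤ θ i j) ∧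
    (∀ i j, ¬(i ∈ R ∧ j ∈ C) → θ i j = 0)}

/-- Risk of the test with rejection region `T`: type-I error plus worst-case type-II error. -/
def testRisk (n N : ℕ) (A : ℝ) (T : Set (Fin N → Fin N → ℝ)) : ℝ :=
  (PTheta N 0 T).toReal + ⨆ θ : ThetaSet A n N, (PTheta N θ.1 Tᶜ).toReal

/-- Minimax risk over all (measurable) tests. -/
def minimaxRisk (n N : ℕ) (A : ℝ) : ℝ :=
  ⨅ T : {T : Set (Fin N → Fin N → ℝ) // MeasurableSet T}, testRisk n N A T.1

/-- The family S of n×n product subsets R×C of [N]×[N]. -/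
def SIdx (n N : ℕ) : Type :=
  {p : Finset (Fin N) × Finset (Fin N) // p.1.card = n ∧ p.2.card = n}

instance (n N : ℕ) : Fintype (SIdx n N) := by unfold SIdx; infer_instance

/-- The sum X_S of the entries of x over the product set S = R×C. -/
def XS {n N : ℕ} (S : SIdx n N) (x : Fin N → Fin N → ℝ) : ℝ :=
  ∑ i ∈ S.1.1, ∑ j ∈ S.1.2, x i j

/-- The standard normal CDF Φ. -/
def stdGaussianCDF (x : ℝ) : ℝ := ((gaussianReal 0 1) (Set.Iic x)).toReal

/-- The inverse Φ⁻¹ of the standard normal CDF. -/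
def stdGaussianInvCDF : ℝ → ℝ := Function.invFun stdGaussianCDF

/-- The likelihood ratio truncated at level c:
`L'_π = (1/|S|) Σ_S exp(A X_S − A²n²/2) 1{X_S ≤ c}`. -/
def LpiTrunc (n N : ℕ) (A c : ℝ) (x : Fin N → Fin N → ℝ) : ℝ :=
  (((N.choose n : ℝ)) ^ 2)⁻¹ * ∑ S : SIdx n N,
    {y | XS S y ≤ c}.indicator (fun y => Real.exp (A * XS S y - A ^ 2 * (n : ℝ) ^ 2 / 2)) x

instance (N : ℕ) (θ : Fin N → Fin N → ℝ) : IsProbabilityMeasure (PTheta N θ) := by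
  unfold PTheta; infer_instance

/-- sum over an arbitrary finite set of entries -/
def XT {N : ℕ} (T : Finset (Fin N × Fin N)) (x : Fin N → Fin N → ℝ) : ℝ :=
  ∑ q ∈ T, x q.1 q.2

lemma XT_measurable {N : ℕ} (T : Finset (Fin N × Fin N)) : Measurable (XT T) := by
  unfold XT; fun_prop

lemma XS_eq_XT {n N : ℕ} (S : SIdx n N) : XS S = XT (S.1.1 ×ˢ S.1.2) := by
  funext x
  simp [XS, XT, Finset.sum_product]

lemma coord_law (N : ℕ) (q : Fin N × Fin N) :
    (PTheta N 0).map (fun x => x q.1 q.2) = gaussianReal 0 1 := by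
  have h1 : MeasurePreserving (Function.eval q.1) (PTheta N 0)
      (Measure.pi fun _ : Fin N => gaussianReal 0 1) :=
    measurePreserving_eval (fun _ : Fin N => Measure.pi fun _ : Fin N => gaussianReal 0 1) q.1
  have h2 : MeasurePreserving (Function.eval q.2) (Measure.pi fun _ : Fin N => gaussianReal 0 1)
      (gaussianReal 0 1) := measurePreserving_eval (fun _ : Fin N => gaussianReal 0 1) q.2
  exact (h2.comp h1).map_eq

lemma coords_indep (N : ℕ) :
    iIndepFun (fun (q : Fin N × Fin N) (x : Fin N → Fin N → ℝ) => x q.1 q.2) (PTheta N 0) := by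
  have h := iIndepFun_uncurry' (P := PTheta N 0)
    (X := fun (i : Fin N) (j : Fin N) (x : Fin N → Fin N → ℝ) => x i j) (by fun_prop) ?_ ?_
  · exact h
  · unfold PTheta
    exact iIndepFun_pi (X := fun i (y : Fin N → ℝ) => y) (by fun_prop)
  · intro i
    have h1 : MeasurePreserving (Function.eval i) (PTheta N 0)
      (Measure.pi fun _ : Fin N => gaussianReal 0 1) :=
      measurePreserving_eval (fun _ : Fin N => Measure.pi fun _ : Fin N => gaussianReal 0 1) i
    refine (iIndepFun_iff_map_fun_eq_pi_map (fun j =>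
      (by fun_prop : Measurable fun x : Fin N → Fin N → ℝ => x i j).aemeasurable)).2 ?_
    have h3 : ∀ j : Fin N, (PTheta N 0).map (fun x => x i j) = gaussianReal 0 1 :=
      fun j => coord_law N (i, j)
    simp_rw [h3]
    exact h1.map_eq

lemma XT_law {N : ℕ} (T : Finset (Fin N × Fin N)) :
    (PTheta N 0).map (XT T) = gaussianReal 0 (T.card) := by
  classical
  induction T using Finset.induction_on with
  | empty =>
    have : XT (∅ : Finset (Fin N × Fin N)) = fun _ => (0:ℝ) := by funext x; simp [XT]
    simp [this]
  | insert q T hq ih =>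
    have h := (coords_indep N).indepFun_finsetSum_of_notMem (by fun_prop) hq
    have h2 := gaussianReal_add_gaussianReal_of_indepFun (X := XT T) (Y := fun x => x q.1 q.2)
      (by convert h using 1; funext x; simp [XT]) ih (coord_law N q)
    have : XT (insert q T) = XT T + fun x => x q.1 q.2 := by
      funext x; simp [XT, Finset.sum_insert hq, add_comm]
    rw [this, h2, Finset.card_insert_of_notMem hq]; simp

lemma XT_indep {N : ℕ} {S T : Finset (Fin N × Fin N)} (h : Disjoint S T) :
    IndepFun (XT S) (XT T) (PTheta N 0) := by
  have h1 := (coords_indep N).indepFun_finset S T h (by fun_prop)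
  have h2 := h1.comp (φ := fun y => ∑ i, y i) (ψ := fun y => ∑ i, y i) (by fun_prop) (by fun_prop)
  have e : ∀ S : Finset (Fin N × Fin N), XT S = (fun y => ∑ i, y i) ∘
      (fun (a : Fin N → Fin N → ℝ) (i : S) => a i.1.1 i.1.2) := by
    intro S; funext x
    simp only [XT, Function.comp]
    rw [← Finset.sum_coe_sort]
  rw [e S, e T]; exact h2

lemma XT_indep3 {N : ℕ} {K P Q : Finset (Fin N × Fin N)} (h1 : Disjoint K P) (h2 : Disjoint K Q) :
    IndepFun (XT K) (fun x => (XT P x, XT Q x)) (PTheta N 0) := by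
  classical
  have h := (coords_indep N).indepFun_finset K (P ∪ Q) (by simp [Finset.disjoint_union_right, h1, h2]) (by fun_prop)
  have hm : Measurable (fun y : (P ∪ Q : Finset (Fin N × Fin N)) → ℝ =>
      (∑ i, (if i.1 ∈ P then y i else 0), ∑ i, (if i.1 ∈ Q then y i else 0))) := by
    refine Measurable.prodMk ?_ ?_ <;>
    · refine Finset.measurable_sum _ fun i _ => ?_
      split_ifs <;> fun_prop
  have h2 := h.comp (φ := fun y => ∑ i, y i) (by fun_prop) hm
  have e : XT K = (fun y => ∑ i, y i) ∘
      (fun (a : Fin N → Fin N → ℝ) (i : K) => a i.1.1 i.1.2) := by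
    funext x
    simp only [XT, Function.comp]
    rw [← Finset.sum_coe_sort]
  have e2 : ∀ R ⊆ P ∪ Q, ∀ x, XT R x = ∑ i : (P ∪ Q : Finset (Fin N × Fin N)),
      (if i.1 ∈ R then x i.1.1 i.1.2 else 0) := by
    intro R hR x
    rw [Finset.sum_coe_sort (P ∪ Q) (fun i => if i ∈ R then x i.1 i.2 else 0)]
    rw [Finset.sum_ite_mem, Finset.inter_eq_right.2 hR, XT]
  have e3 : (fun x => (XT P x, XT Q x)) = (fun y : (P ∪ Q : Finset (Fin N × Fin N)) → ℝ => (∑ i, (if i.1 ∈ P then y i else 0), ∑ i, (if i.1 ∈ Q then y i else 0))) ∘ (fun (a : Fin N → Fin N → ℝ) (i : (P ∪ Q : Finset (Fin N × Fin N))) => a i.1.1 i.1.2) := by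
    funext x
    simp only [Function.comp]
    rw [e2 P Finset.subset_union_left, e2 Q Finset.subset_union_right]
  rw [e, e3]; exact h2

lemma XT_triple {N : ℕ} {K P Q : Finset (Fin N × Fin N)} (h1 : Disjoint K P) (h2 : Disjoint K Q)
    (h3 : Disjoint P Q) :
    (PTheta N 0).map (fun x => (XT K x, XT P x, XT Q x)) =
      (gaussianReal 0 K.card).prod ((gaussianReal 0 P.card).prod (gaussianReal 0 Q.card)) := by
  have a := (XT_indep3 h1 h2).map_prod_eq_prod_map_map (XT_measurable _).aemeasurable
    ((XT_measurable _).prodMk (XT_measurable _)).aemeasurable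
  have b := (XT_indep h3).map_prod_eq_prod_map_map (XT_measurable _).aemeasurable
    (XT_measurable _).aemeasurable
  rw [a, b, XT_law, XT_law, XT_law]

open scoped NNReal

lemma gauss_tilt (c : ℝ) (v : ℝ≥0) (f : ℝ → ℝ) :
    ∫ u, exp (c * u) * f u ∂(gaussianReal 0 v)
      = exp (c ^ 2 * v / 2) * ∫ u, f (u + c * v) ∂(gaussianReal 0 v) := by
  by_cases hv : v = 0
  · subst hv; simp
  have e1 : ∫ u, f (u + c * v) ∂(gaussianReal 0 v) = ∫ u, f u ∂(gaussianReal (c * v) v) := by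
    have h := gaussianReal_map_add_const (μ := 0) (v := v) (c * v)
    rw [zero_add] at h
    rw [← h, (measurableEmbedding_addRight (c * (v:ℝ))).integral_map]
  rw [e1, integral_gaussianReal_eq_integral_smul hv, integral_gaussianReal_eq_integral_smul hv,
    ← integral_const_mul]
  congr 1
  funext u
  have hv' : (v : ℝ) ≠ 0 := by exact_mod_cast hv
  have : gaussianPDFReal 0 v u * exp (c * u) = exp (c ^ 2 * v / 2) * gaussianPDFReal (c * v) v u := by
    simp only [gaussianPDFReal]
    rw [mul_assoc, ← exp_add, mul_left_comm, ← exp_add]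
    congr 2
    field_simp
    ring
  simp only [smul_eq_mul]
  rw [← mul_assoc, this]; ring

lemma Phi_eq_cdf (x : ℝ) : stdGaussianCDF x = cdf (gaussianReal 0 1) x := by
  rw [cdf_eq_real]; rfl

lemma Phi_mono : Monotone stdGaussianCDF := by
  intro x y h
  rw [Phi_eq_cdf, Phi_eq_cdf]; exact monotone_cdf _ h

lemma Phi_nonneg (x : ℝ) : 0 ≤ stdGaussianCDF x := by
  rw [Phi_eq_cdf]; exact cdf_nonneg _ _

lemma Phi_le_one (x : ℝ) : stdGaussianCDF x ≤ 1 := by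
  rw [Phi_eq_cdf]; exact cdf_le_one _ _

lemma Phi_measurable : Measurable stdGaussianCDF := Phi_mono.measurable

lemma pdf_le_one (u : ℝ) : gaussianPDFReal 0 1 u ≤ 1 := by
  simp only [gaussianPDFReal]
  have h1 : exp (-(u - 0) ^ 2 / (2 * ((1:ℝ≥0):ℝ))) ≤ 1 := by
    rw [exp_le_one_iff]
    apply div_nonpos_of_nonpos_of_nonneg
    · linarith [sq_nonneg (u - 0)]
    · positivity
  have h2 : (√(2 * π * ((1:ℝ≥0):ℝ)))⁻¹ ≤ 1 := by
    apply inv_le_one_of_one_le₀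
    rw [Real.one_le_sqrt]
    have := Real.two_le_pi
    simp; nlinarith
  exact mul_le_one₀ h2 (exp_pos _).le h1

lemma Phi_lip_aux {x y : ℝ} (h : x ≤ y) : stdGaussianCDF y - stdGaussianCDF x ≤ y - x := by
  have e : stdGaussianCDF y - stdGaussianCDF x = (gaussianReal 0 1).real (Set.Ioc x y) := by
    have : Set.Ioc x y = Set.Iic y \ Set.Iic x := by ext; simp [and_comm]
    rw [this, measureReal_sdiff (Set.Iic_subset_Iic.2 h) measurableSet_Iic]
    rfl
  rw [e, Measure.real, gaussianReal_apply_eq_integral _ one_ne_zero, ENNReal.toReal_ofReal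
    (setIntegral_nonneg measurableSet_Ioc fun u _ => gaussianPDFReal_nonneg _ _ _)]
  calc ∫ u in Set.Ioc x y, gaussianPDFReal 0 1 u ≤ ∫ u in Set.Ioc x y, (1:ℝ) := by
        refine setIntegral_mono ?_ ?_ pdf_le_one
        · exact (integrable_gaussianPDFReal 0 1).integrableOn
        · simp
    _ = y - x := by simp [h]

lemma Phi_lip (x y : ℝ) : |stdGaussianCDF x - stdGaussianCDF y| ≤ |x - y| := by
  rcases le_total x y with h | h
  · rw [abs_sub_comm, abs_of_nonneg (sub_nonneg.2 (Phi_mono h)), abs_sub_comm,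
      abs_of_nonneg (sub_nonneg.2 h)]
    exact Phi_lip_aux h
  · rw [abs_of_nonneg (sub_nonneg.2 (Phi_mono h)), abs_of_nonneg (sub_nonneg.2 h)]
    exact Phi_lip_aux h

lemma Phi_continuous : Continuous stdGaussianCDF := by
  have : LipschitzWith 1 stdGaussianCDF := LipschitzWith.of_dist_le_mul fun x y => by
    simpa [Real.dist_eq] using Phi_lip x y
  exact this.continuous

lemma Phi_surj {p : ℝ} (h0 : 0 < p) (h1 : p < 1) : ∃ x, stdGaussianCDF x = p := by
  have e : stdGaussianCDF = cdf (gaussianReal 0 1) := funext Phi_eq_cdf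
  have ht : Tendsto stdGaussianCDF atTop (𝓝 1) := e ▸ tendsto_cdf_atTop _
  have hb : Tendsto stdGaussianCDF atBot (𝓝 0) := e ▸ tendsto_cdf_atBot _
  obtain ⟨a, ha⟩ := (hb.eventually (gt_mem_nhds h0)).exists
  obtain ⟨b, hb⟩ := (ht.eventually (lt_mem_nhds h1)).exists
  exact mem_range_of_exists_le_of_exists_ge Phi_continuous ⟨a, ha.le⟩ ⟨b, hb.le⟩

lemma Phi_inv {p : ℝ} (h0 : 0 < p) (h1 : p < 1) : stdGaussianCDF (stdGaussianInvCDF p) = p :=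
  Function.invFun_eq (Phi_surj h0 h1)

/-- crude tail bound -/
lemma Phi_tail (z : ℝ) : 1 - stdGaussianCDF z ≤ exp (1 / 2 - z) := by
  have h := measure_ge_le_exp_mul_mgf (μ := gaussianReal 0 1) (X := id) (t := 1) z zero_le_one
    (by simpa using integrable_exp_mul_gaussianReal (μ := 0) (v := 1) 1)
  rw [mgf_id_gaussianReal] at h
  have e : 1 - stdGaussianCDF z = (gaussianReal 0 1).real (Set.Ioi z) := by
    have : Set.Ioi z = (Set.Iic z)ᶜ := by simp
    rw [this, probReal_compl_eq_one_sub measurableSet_Iic]; rfl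
  rw [e]
  calc (gaussianReal 0 1).real (Set.Ioi z) ≤ (gaussianReal 0 1).real {ω | z ≤ id ω} :=
        measureReal_mono (fun x (hx : z < x) => (le_of_lt hx : z ≤ x))
    _ ≤ _ := h
    _ = exp (1 / 2 - z) := by rw [← exp_add]; congr 1; simp; ring

lemma gauss_Iic {v : ℝ≥0} (hv : v ≠ 0) (t : ℝ) :
    (gaussianReal 0 v).real (Set.Iic t) = stdGaussianCDF (t / √v) := by
  have hp : 0 < √(v:ℝ) := Real.sqrt_pos.2 (by positivity)
  have h := gaussianReal_map_const_mul (μ := 0) (v := 1) (√(v:ℝ))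
  have e : gaussianReal 0 v = (gaussianReal 0 1).map (√(v:ℝ) * ·) := by
    rw [h]; congr 1
    · simp
    · ext; simp
  rw [e, map_measureReal_apply (by fun_prop) measurableSet_Iic, stdGaussianCDF, Measure.real]
  congr 2
  ext x; simp [le_div_iff₀ hp, mul_comm]

/-- summand of the truncated likelihood, as a function of `X_S` -/
def hT (A d B y : ℝ) : ℝ := (Set.Iic B).indicator (fun y => exp (A * y - A ^ 2 * d / 2)) y

lemma hT_measurable (A d B : ℝ) : Measurable (hT A d B) := by
  unfold hT; exact Measurable.indicator (by fun_prop) measurableSet_Iic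

lemma hT_nonneg (A d B y : ℝ) : 0 ≤ hT A d B y :=
  Set.indicator_nonneg (fun _ _ => (exp_pos _).le) _

lemma hT_le {A : ℝ} (hA : 0 ≤ A) (d B y : ℝ) : hT A d B y ≤ exp (A * B - A ^ 2 * d / 2) := by
  unfold hT Set.indicator
  split_ifs with h
  · have : A * y ≤ A * B := mul_le_mul_of_nonneg_left h hA
    exact exp_le_exp.2 (by linarith)
  · positivity

lemma hT_int {v : ℝ≥0} (hv : v ≠ 0) (A d B u : ℝ) :
    ∫ y, hT A d B (u + y) ∂(gaussianReal 0 v) =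
      exp (A * u - A ^ 2 * d / 2 + A ^ 2 * v / 2) * stdGaussianCDF ((B - u - A * v) / √v) := by
  have e : ∀ y, hT A d B (u + y) = exp (A * y) *
      (exp (A * u - A ^ 2 * d / 2) * (Set.Iic (B - u)).indicator 1 y) := by
    intro y
    unfold hT Set.indicator
    have : u + y ∈ Set.Iic B ↔ y ∈ Set.Iic (B - u) := by
      simp only [Set.mem_Iic]; constructor <;> intro h <;> linarith
    simp only [this]
    split_ifs
    · simp only [Pi.one_apply, mul_one]; rw [← exp_add]; congr 1; ring
    · simp
  simp_rw [e]
  rw [gauss_tilt, integral_const_mul]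
  have e2 : ∀ y, (Set.Iic (B - u)).indicator (1 : ℝ → ℝ) (y + A * v) =
      (Set.Iic (B - u - A * v)).indicator 1 y := by
    intro y
    unfold Set.indicator
    have : y + A * v ∈ Set.Iic (B - u) ↔ y ∈ Set.Iic (B - u - A * v) := by
      simp only [Set.mem_Iic]; constructor <;> intro h <;> linarith
    simp only [this, Pi.one_apply]
  simp_rw [e2]
  rw [integral_indicator_one measurableSet_Iic, gauss_Iic hv, ← mul_assoc, ← exp_add]
  congr 2; ring

lemma Phi_conv (k : ℝ≥0) {m : ℝ≥0} (hm : m ≠ 0) (t : ℝ) :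
    ∫ u, stdGaussianCDF ((t - u) / √m) ∂(gaussianReal 0 k) = stdGaussianCDF (t / √(k + m : ℝ≥0)) := by
  have h := gaussianReal_conv_gaussianReal (m₁ := 0) (m₂ := 0) (v₁ := k) (v₂ := m)
  rw [zero_add] at h
  have e1 : ∫ y, (Set.Iic t).indicator (1 : ℝ → ℝ) y ∂(gaussianReal 0 (k+m)) = stdGaussianCDF (t / √(k + m : ℝ≥0)) := by
    rw [integral_indicator_one measurableSet_Iic, gauss_Iic (by simp [hm])]
  rw [← e1, ← h, integral_conv]
  · congr 1; funext u
    rw [← gauss_Iic hm, ← integral_indicator_one measurableSet_Iic]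
    congr 1; funext y
    unfold Set.indicator
    have : u + y ∈ Set.Iic t ↔ y ∈ Set.Iic (t - u) := by
      simp only [Set.mem_Iic]; constructor <;> intro h <;> linarith
    simp only [this, Pi.one_apply]
  · rw [h]
    exact (integrable_const (1:ℝ)).indicator measurableSet_Iic

lemma Phi_comp_integrable (k : ℝ≥0) (m t : ℝ) :
    Integrable (fun u => stdGaussianCDF ((t - u) / √m)) (gaussianReal 0 k) :=
  Integrable.of_bound (Phi_measurable.comp (by fun_prop)).aestronglyMeasurable 1
    (ae_of_all _ fun u => by rw [Real.norm_of_nonneg (Phi_nonneg _)]; exact Phi_le_one _)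

lemma Phi_sq (k : ℝ≥0) {m : ℝ≥0} (hm : m ≠ 0) (t : ℝ) :
    ∫ u, stdGaussianCDF ((t - u) / √m) ^ 2 ∂(gaussianReal 0 k) ≤
      stdGaussianCDF (t / √(k + m : ℝ≥0)) ^ 2 + k / m := by
  set f : ℝ → ℝ := fun u => stdGaussianCDF ((t - u) / √m) with hf
  have hm0 : 0 < (m:ℝ) := by positivity
  set a := stdGaussianCDF (t / √m) with ha
  have i1 : Integrable f (gaussianReal 0 k) := Phi_comp_integrable k m t
  have i2 : Integrable (fun u => f u ^ 2) (gaussianReal 0 k) :=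
    Integrable.of_bound (i1.aestronglyMeasurable.pow 2) 1
      (ae_of_all _ fun u => by
        rw [Real.norm_of_nonneg (sq_nonneg _)]
        exact pow_le_one₀ (Phi_nonneg _) (Phi_le_one _))
  have hid : ∫ u, u ^ 2 ∂(gaussianReal 0 k) = k := by
    have h := variance_id_gaussianReal (μ := 0) (v := k)
    rw [variance_of_integral_eq_zero (by fun_prop) (by simp)] at h
    simpa using h
  have i3 : Integrable (fun u : ℝ => u ^ 2) (gaussianReal 0 k) := by
    have := (memLp_id_gaussianReal (μ := 0) (v := k) 2).integrable_sq
    simpa using this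
  have hconv : ∫ u, f u ∂(gaussianReal 0 k) = stdGaussianCDF (t / √(k + m : ℝ≥0)) := Phi_conv k hm t
  have h1 : ∫ u, (f u ^ 2 - 2 * a * f u + a ^ 2) ∂(gaussianReal 0 k) ≤ ∫ u, (1 / m) * u ^ 2 ∂(gaussianReal 0 k) := by
    refine integral_mono ((i2.sub (i1.const_mul _)).add (integrable_const _)) (i3.const_mul _) fun u => ?_
    have h := Phi_lip ((t - u) / √m) (t / √m)
    have h2 : (f u - a) ^ 2 ≤ ((t - u) / √m - t / √m) ^ 2 := sq_le_sq.2 h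
    have h3 : ((t - u) / √m - t / √m) ^ 2 = (1 / m) * u ^ 2 := by
      rw [← sub_div, div_pow, Real.sq_sqrt hm0.le]; ring
    simp only
    nlinarith
  have i4 : Integrable (fun u => f u ^ 2 - 2 * a * f u) (gaussianReal 0 k) := i2.sub (i1.const_mul _)
  rw [integral_add i4 (integrable_const _), integral_sub i2 (i1.const_mul _),
    integral_const_mul, integral_const_mul, hconv, hid] at h1
  simp only [integral_const, probReal_univ, one_smul] at h1
  have := sq_nonneg (stdGaussianCDF (t / √(k + m : ℝ≥0)) - a)
  have e : (1:ℝ) / m * k = k / m := by ring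
  rw [e] at h1
  show ∫ u, f u ^ 2 ∂(gaussianReal 0 k) ≤ _
  nlinarith

/-- joint law of shared part and two private parts -/
abbrev tri (k m : ℝ≥0) : Measure (ℝ × ℝ × ℝ) :=
  (gaussianReal 0 k).prod ((gaussianReal 0 m).prod (gaussianReal 0 m))

lemma hT_integrable {Ω : Type*} [MeasurableSpace Ω] {μ : Measure Ω} [IsFiniteMeasure μ]
    {A : ℝ} (hA : 0 ≤ A) (d B : ℝ) {f : Ω → ℝ} (hf : Measurable f) :
    Integrable (fun x => hT A d B (f x)) μ :=
  Integrable.of_bound ((hT_measurable A d B).comp hf).aestronglyMeasurable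
    (exp (A * B - A ^ 2 * d / 2))
    (ae_of_all _ fun u => by rw [Real.norm_of_nonneg (hT_nonneg _ _ _ _)]; exact hT_le hA _ _ _)

lemma hT_mul_integrable {Ω : Type*} [MeasurableSpace Ω] {μ : Measure Ω} [IsFiniteMeasure μ]
    {A : ℝ} (hA : 0 ≤ A) (d B : ℝ) {f g : Ω → ℝ} (hf : Measurable f) (hg : Measurable g) :
    Integrable (fun x => hT A d B (f x) * hT A d B (g x)) μ :=
  (hT_integrable hA d B hg).bdd_mul ((hT_measurable A d B).comp hf).aestronglyMeasurable
    (c := exp (A * B - A ^ 2 * d / 2))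
    (ae_of_all _ fun u => by
      rw [Real.norm_of_nonneg (hT_nonneg _ _ _ _)]; exact hT_le hA _ _ _)

lemma pair_small {A : ℝ} (hA : 0 ≤ A) (k : ℝ≥0) {m : ℝ≥0} (hm : m ≠ 0) (n z B : ℝ) (hn : 0 < n)
    (hkm : (k : ℝ) + m = n ^ 2) (hB : B = A * n ^ 2 + z * n) :
    ∫ x, hT A (n ^ 2) B (x.1 + x.2.1) * hT A (n ^ 2) B (x.1 + x.2.2) ∂(tri k m) ≤
      exp (A ^ 2 * k) * (stdGaussianCDF z ^ 2 + k / m) := by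
  have hm0 : 0 < (m:ℝ) := by positivity
  rw [integral_prod _ (hT_mul_integrable hA _ _ (by fun_prop) (by fun_prop))]
  have e1 : ∀ u : ℝ, ∫ y : ℝ × ℝ, hT A (n ^ 2) B (u + y.1) * hT A (n ^ 2) B (u + y.2)
      ∂((gaussianReal 0 m).prod (gaussianReal 0 m)) =
      exp (2 * A * u) * (exp (- A ^ 2 * k) * stdGaussianCDF ((B - u - A * m) / √m) ^ 2) := by
    intro u
    rw [integral_prod_mul (fun v => hT A (n ^ 2) B (u + v)) (fun v => hT A (n ^ 2) B (u + v)),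
      hT_int hm]
    have : exp (A * u - A ^ 2 * n ^ 2 / 2 + A ^ 2 * m / 2) ^ 2 = exp (2 * A * u) * exp (- A ^ 2 * k) := by
      rw [← exp_nat_mul, ← exp_add]; congr 1
      rw [← hkm]; push_cast; ring
    rw [← sq, mul_pow, this]; ring
  simp only [e1]
  rw [gauss_tilt, integral_const_mul, ← mul_assoc, ← exp_add]
  have e2 : (2 * A) ^ 2 * (k:ℝ) / 2 + -A ^ 2 * k = A ^ 2 * k := by ring
  rw [e2]
  refine mul_le_mul_of_nonneg_left ?_ (exp_pos _).le
  have h := Phi_sq k hm (z * n)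
  have e3 : z * n / √((k + m : ℝ≥0) : ℝ) = z := by
    push_cast
    rw [hkm, Real.sqrt_sq hn.le]; field_simp
  rw [e3] at h
  refine le_trans (integral_mono_of_nonneg (ae_of_all _ fun u => sq_nonneg _) ?_
    (ae_of_all _ fun u => ?_)) h
  · refine Integrable.of_bound ((Phi_measurable.comp (by fun_prop)).pow_const 2).aestronglyMeasurable 1
      (ae_of_all _ fun u => ?_)
    rw [Real.norm_of_nonneg (sq_nonneg _)]
    exact pow_le_one₀ (Phi_nonneg _) (Phi_le_one _)
  · refine pow_le_pow_left₀ (Phi_nonneg _) (Phi_mono ?_) 2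
    refine div_le_div_of_nonneg_right ?_ (Real.sqrt_nonneg _)
    have : 0 ≤ A * k := by positivity
    rw [hB, ← hkm]; nlinarith

lemma gauss_mgf (v : ℝ≥0) (c : ℝ) : ∫ u, exp (c * u) ∂(gaussianReal 0 v) = exp (c ^ 2 * v / 2) := by
  have := gauss_tilt c v (fun _ => 1)
  simpa using this

lemma pair_chernoff {A : ℝ} (hA : 0 ≤ A) (k m : ℝ≥0) (n z B : ℝ) (hn : 0 < n)
    (hkm : (k : ℝ) + m = n ^ 2) (hB : B = A * n ^ 2 + z * n) (z' : ℝ) (hz : z ≤ z') (hz' : 0 ≤ z') :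
    ∫ x, hT A (n ^ 2) B (x.1 + x.2.1) * hT A (n ^ 2) B (x.1 + x.2.2) ∂(tri k m) ≤
      exp (A ^ 2 * n ^ 2 * k / (n ^ 2 + k) + A * n * z') := by
  have hd : 0 < n ^ 2 + (k:ℝ) := by positivity
  set s : ℝ := A * k / (n ^ 2 + k) with hs
  have hs0 : 0 ≤ s := by positivity
  have hs2 : s * (n ^ 2 + k) = A * k := by rw [hs]; field_simp
  have hsA : 2 * s ≤ A := by
    rw [hs, ← mul_div_assoc, div_le_iff₀ hd]
    have : (k:ℝ) ≤ n ^ 2 := by rw [← hkm]; simp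
    nlinarith
  have key : ∀ x : ℝ × ℝ × ℝ, hT A (n ^ 2) B (x.1 + x.2.1) * hT A (n ^ 2) B (x.1 + x.2.2) ≤
      exp (- A ^ 2 * n ^ 2 + 2 * s * B) * (exp (2 * (A - s) * x.1) * (exp ((A - s) * x.2.1) * exp ((A - s) * x.2.2))) := by
    intro x
    have h1 : ∀ y, hT A (n ^ 2) B y ≤ exp (A * y - A ^ 2 * n ^ 2 / 2 + s * (B - y)) := by
      intro y
      unfold hT Set.indicator
      split_ifs with h
      · have : 0 ≤ s * (B - y) := mul_nonneg hs0 (sub_nonneg.2 h)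
        exact exp_le_exp.2 (by linarith)
      · positivity
    refine (mul_le_mul (h1 _) (h1 _) (hT_nonneg _ _ _ _) (exp_pos _).le).trans (le_of_eq ?_)
    simp only [← exp_add]
    congr 1; ring
  have hi : ∀ (v : ℝ≥0) (c : ℝ), Integrable (fun u => exp (c * u)) (gaussianReal 0 v) :=
    fun v c => integrable_exp_mul_gaussianReal c
  have h2 := integral_mono (μ := tri k m) (hT_mul_integrable hA (n ^ 2) B (f := fun x : ℝ × ℝ × ℝ => x.1 + x.2.1)
    (g := fun x : ℝ × ℝ × ℝ => x.1 + x.2.2) (by fun_prop) (by fun_prop))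
    ((((hi k (2 * (A - s))).mul_prod ((hi m (A - s)).mul_prod (hi m (A - s))))).const_mul
      (exp (- A ^ 2 * n ^ 2 + 2 * s * B))) key
  refine h2.trans ?_
  rw [integral_const_mul, integral_prod_mul (fun u => exp (2 * (A - s) * u))
    (fun y : ℝ × ℝ => exp ((A - s) * y.1) * exp ((A - s) * y.2)),
    integral_prod_mul (fun u => exp ((A - s) * u)) (fun u => exp ((A - s) * u)), gauss_mgf, gauss_mgf]
  simp only [← exp_add]
  apply exp_le_exp.2
  have hA1 : A ^ 2 * n ^ 2 * k / (n ^ 2 + k) = s * A * n ^ 2 := by rw [hs]; ring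
  rw [hA1, hB]
  have hz2 : 2 * s * (z * n) ≤ A * n * z' := by
    calc 2 * s * (z * n) = 2 * s * n * z := by ring
      _ ≤ 2 * s * n * z' := by gcongr
      _ ≤ A * n * z' := by gcongr
  have hm' : (m:ℝ) = n ^ 2 - k := by linarith
  rw [hm']
  have e : (2 * (A - s)) ^ 2 * (k:ℝ) / 2 + ((A - s) ^ 2 * (n ^ 2 - k) / 2 + (A - s) ^ 2 * (n ^ 2 - k) / 2)
     = (A - s) * (A * (n^2 + k) - s * (n ^ 2 + k)) := by ring
  rw [e, hs2]
  nlinarith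

/-- overlap of two index sets -/
def ov {n N : ℕ} (S S' : SIdx n N) : ℕ := (S.1.1 ∩ S'.1.1).card * (S.1.2 ∩ S'.1.2).card

lemma ov_le {n N : ℕ} (S S' : SIdx n N) : ov S S' ≤ n ^ 2 := by
  rw [sq]
  refine Nat.mul_le_mul ?_ ?_
  · exact (Finset.card_le_card Finset.inter_subset_left).trans S.2.1.le
  · exact (Finset.card_le_card Finset.inter_subset_left).trans S.2.2.le

lemma pair_law {n N : ℕ} (S S' : SIdx n N) {A : ℝ} (d B : ℝ) :
    ∫ x, hT A d B (XS S x) * hT A d B (XS S' x) ∂(PTheta N 0) =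
    ∫ x, hT A d B (x.1 + x.2.1) * hT A d B (x.1 + x.2.2) ∂(tri (ov S S') ((n ^ 2 - ov S S' : ℕ) : ℝ≥0)) := by
  classical
  set U := S.1.1 ×ˢ S.1.2 with hU
  set U' := S'.1.1 ×ˢ S'.1.2 with hU'
  have cU : U.card = n ^ 2 := by rw [hU, Finset.card_product, S.2.1, S.2.2, sq]
  have cU' : U'.card = n ^ 2 := by rw [hU', Finset.card_product, S'.2.1, S'.2.2, sq]
  have hK : (U ∩ U').card = ov S S' := by
    rw [hU, hU', Finset.product_inter_product, Finset.card_product]; rfl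
  have hP : (U \ U').card = n ^ 2 - ov S S' := by
    rw [Finset.card_sdiff, Finset.inter_comm, cU, hK]
  have hQ : (U' \ U).card = n ^ 2 - ov S S' := by
    rw [Finset.card_sdiff, cU', hK]
  have h := XT_triple (N := N) (K := U ∩ U') (P := U \ U') (Q := U' \ U)
    (by rw [Finset.disjoint_left]; intro a; simp; tauto)
    (by rw [Finset.disjoint_left]; intro a; simp; tauto)
    (by rw [Finset.disjoint_left]; intro a; simp; tauto)
  rw [hK, hP, hQ] at h
  have hm : Measurable (fun x => (XT (U ∩ U') x, XT (U \ U') x, XT (U' \ U) x)) :=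
    (XT_measurable _).prodMk ((XT_measurable _).prodMk (XT_measurable _))
  rw [tri, ← h, integral_map hm.aemeasurable]
  · congr 1
    funext x
    have e1 : XS S x = XT (U ∩ U') x + XT (U \ U') x := by
      rw [XS_eq_XT]; simp only [XT]; rw [Finset.sum_inter_add_sum_sdiff]
    have e2 : XS S' x = XT (U ∩ U') x + XT (U' \ U) x := by
      rw [XS_eq_XT, Finset.inter_comm]; simp only [XT]; rw [Finset.sum_inter_add_sum_sdiff]
    rw [e1, e2]
  · refine Measurable.aestronglyMeasurable ?_
    exact ((hT_measurable A d B).comp (by fun_prop)).mul ((hT_measurable A d B).comp (by fun_prop))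

lemma single_law {n N : ℕ} (hn : 0 < n) (S : SIdx n N) {A : ℝ} (z B : ℝ)
    (hB : B = A * (n:ℝ) ^ 2 + z * n) :
    ∫ x, hT A ((n:ℝ) ^ 2) B (XS S x) ∂(PTheta N 0) = stdGaussianCDF z := by
  have hn' : (0:ℝ) < n := by exact_mod_cast hn
  rw [XS_eq_XT, ← integral_map (XT_measurable _).aemeasurable (hT_measurable _ _ _).aestronglyMeasurable, XT_law,
    Finset.card_product, S.2.1, S.2.2]
  have h := hT_int (v := ((n * n : ℕ) : ℝ≥0)) (by simp; omega) A ((n:ℝ) ^ 2) B 0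
  simp only [zero_add] at h
  rw [h]
  have e : A * 0 - A ^ 2 * (n:ℝ) ^ 2 / 2 + A ^ 2 * (((n * n : ℕ) : ℝ≥0) : ℝ) / 2 = 0 := by
    push_cast; ring
  rw [e, exp_zero, one_mul, hB]
  congr 1
  push_cast
  rw [← sq, Real.sqrt_sq hn'.le]; field_simp; ring

/-! ### Combinatorics -/

lemma card_superset {N n r : ℕ} (T : Finset (Fin N)) (hT : T.card = r) (hr : r ≤ n) :
    ((Finset.powersetCard n (Finset.univ : Finset (Fin N))).filter (fun R' => T ⊆ R')).card
      = (N - r).choose (n - r) := by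
  classical
  have h1 : (Finset.powersetCard (n - r) (Tᶜ : Finset (Fin N))).card = (N - r).choose (n - r) := by
    rw [Finset.card_powersetCard, Finset.card_compl, hT, Fintype.card_fin]
  rw [← h1]
  refine Finset.card_bij' (fun R' _ => R' \ T) (fun Q _ => Q ∪ T) ?_ ?_ ?_ ?_
  · intro R' h
    simp only [Finset.mem_filter, Finset.mem_powersetCard, Finset.subset_univ, true_and] at h ⊢
    refine ⟨fun a => by simp, ?_⟩
    rw [Finset.card_sdiff_of_subset h.2, h.1, hT]
  · intro Q h
    simp only [Finset.mem_filter, Finset.mem_powersetCard, Finset.subset_univ, true_and] at h ⊢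
    refine ⟨?_, Finset.subset_union_right⟩
    rw [Finset.card_union_of_disjoint, h.2, hT]
    · omega
    · rw [Finset.disjoint_left]; intro a ha; simpa using h.1 ha
  · intro R' h
    simp only [Finset.mem_filter] at h
    exact Finset.sdiff_union_of_subset h.2
  · intro Q h
    simp only [Finset.mem_powersetCard] at h
    ext a
    have : a ∈ Q → a ∉ T := fun ha => by simpa using h.1 ha
    simp; tauto

lemma sum_choose {N n r : ℕ} (R : Finset (Fin N)) (hR : R.card = n) (hr : r ≤ n) :
    ∑ R' ∈ Finset.powersetCard n (Finset.univ : Finset (Fin N)), (R ∩ R').card.choose r =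
      n.choose r * (N - r).choose (n - r) := by
  classical
  have h1 : ∀ R' : Finset (Fin N), (R ∩ R').card.choose r =
      ∑ T ∈ Finset.powersetCard r R, if T ⊆ R' then 1 else 0 := by
    intro R'
    rw [← Finset.card_powersetCard, ← Finset.card_filter]
    congr 1
    ext T
    simp only [Finset.mem_powersetCard, Finset.mem_filter, Finset.subset_inter_iff]; tauto
  simp_rw [h1]
  rw [Finset.sum_comm]
  have h2 : ∀ T ∈ Finset.powersetCard r R, (∑ R' ∈ Finset.powersetCard n (Finset.univ : Finset (Fin N)),
      if T ⊆ R' then 1 else 0) = (N - r).choose (n - r) := by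
    intro T hT
    rw [← Finset.card_filter]
    exact card_superset T (Finset.mem_powersetCard.1 hT).2 hr
  rw [Finset.sum_congr rfl h2, Finset.sum_const, Finset.card_powersetCard, hR, smul_eq_mul]

lemma choose_ratio {N n : ℕ} (hn : 0 < n) (hN : n ≤ N) (r : ℕ) (hr : r ≤ n) :
    ((N - r).choose (n - r) : ℝ) ≤ ((n:ℝ) / N) ^ r * (N.choose n : ℝ) := by
  have hn' : (0:ℝ) < n := by exact_mod_cast hn
  have hN' : (0:ℝ) < N := by exact_mod_cast (lt_of_lt_of_le hn hN)
  induction r with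
  | zero => simp
  | succ r ih =>
    have ih := ih (by omega)
    obtain ⟨a, ha⟩ : ∃ a, N - r = a + 1 := ⟨N - r - 1, by omega⟩
    obtain ⟨b, hb⟩ : ∃ b, n - r = b + 1 := ⟨n - r - 1, by omega⟩
    have ha2 : N - (r + 1) = a := by omega
    have hb2 : n - (r + 1) = b := by omega
    rw [ha2, hb2]
    rw [ha, hb] at ih
    have h := Nat.add_one_mul_choose_eq a b
    have h' : ((a:ℝ) + 1) * (a.choose b) = ((a+1).choose (b+1)) * ((b:ℝ) + 1) := by exact_mod_cast h
    have hab : ((b:ℝ) + 1) * N ≤ n * (a + 1) := by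
      have e1 : (N:ℝ) = a + 1 + r := by exact_mod_cast (by omega : N = a + 1 + r)
      have e2 : (n:ℝ) = b + 1 + r := by exact_mod_cast (by omega : n = b + 1 + r)
      have e3 : (n:ℝ) ≤ N := by exact_mod_cast hN
      have : (0:ℝ) ≤ r := by positivity
      rw [e1, e2] at *
      nlinarith
    have ha0 : (0:ℝ) < a + 1 := by positivity
    have h3 : (a.choose b : ℝ) = ((a+1).choose (b+1)) * (((b:ℝ) + 1) / (a + 1)) := by
      field_simp; linarith
    have h4 : ((b:ℝ) + 1) / (a + 1) ≤ n / N := by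
      rw [div_le_div_iff₀ ha0 hN']; linarith
    rw [h3, pow_succ]
    calc ((a+1).choose (b+1) : ℝ) * (((b:ℝ) + 1) / (a + 1))
        ≤ (((n:ℝ) / N) ^ r * (N.choose n : ℝ)) * (n / N) := by gcongr
      _ = _ := by ring

lemma binom_deriv {n i : ℕ} (hi : i ≤ n) (t : ℝ) :
    ∑ r ∈ Finset.range n, ((r:ℝ) + 1) * t ^ r * (i.choose (r + 1) : ℝ) = i * (1 + t) ^ (i - 1) := by
  rcases i with _ | i
  · simp
  have h1 : ∀ r : ℕ, ((r:ℝ) + 1) * t ^ r * ((i + 1).choose (r + 1) : ℝ) = (i + 1) * (t ^ r * (i.choose r)) := by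
    intro r
    have h := Nat.add_one_mul_choose_eq i r
    have h' : ((i:ℝ) + 1) * (i.choose r) = ((i+1).choose (r+1)) * ((r:ℝ) + 1) := by exact_mod_cast h
    calc ((r:ℝ) + 1) * t ^ r * ((i + 1).choose (r + 1) : ℝ) = t ^ r * (((i+1).choose (r+1)) * ((r:ℝ) + 1)) := by ring
      _ = _ := by rw [← h']; ring
  simp_rw [h1]
  rw [← Finset.mul_sum]
  have h2 : ∑ r ∈ Finset.range n, t ^ r * (i.choose r : ℝ) = ∑ r ∈ Finset.range (i + 1), t ^ r * (i.choose r : ℝ) := by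
    symm
    refine Finset.sum_subset (by intro a; simp; omega) ?_
    intro r _ hr
    rw [Nat.choose_eq_zero_of_lt (by simpa using hr)]; simp
  rw [h2, add_comm (1:ℝ) t, Nat.add_sub_cancel, add_pow t 1 i]
  push_cast; simp

lemma hyper_aux {N n : ℕ} (hn : 0 < n) (hN : n ≤ N) (R : Finset (Fin N)) (hR : R.card = n) {t : ℝ}
    (ht : 0 ≤ t) :
    ∑ R' ∈ Finset.powersetCard n (Finset.univ : Finset (Fin N)),
      ((R ∩ R').card : ℝ) * (1 + t) ^ ((R ∩ R').card - 1) ≤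
      (N.choose n : ℝ) * (((n:ℝ) / N) * (n * (1 + t * (n / N)) ^ (n - 1))) := by
  have h1 : ∀ R' ∈ Finset.powersetCard n (Finset.univ : Finset (Fin N)),
      ((R ∩ R').card : ℝ) * (1 + t) ^ ((R ∩ R').card - 1) =
      ∑ r ∈ Finset.range n, ((r:ℝ) + 1) * t ^ r * ((R ∩ R').card.choose (r + 1) : ℝ) := by
    intro R' _
    rw [binom_deriv]
    exact (Finset.card_le_card Finset.inter_subset_left).trans hR.le
  rw [Finset.sum_congr rfl h1, Finset.sum_comm, ← binom_deriv le_rfl, Finset.mul_sum, Finset.mul_sum]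
  refine Finset.sum_le_sum fun r hr => ?_
  have hr' : r + 1 ≤ n := by simpa using hr
  rw [← Finset.mul_sum]
  have h2 := sum_choose R hR hr'
  have h3 : ∑ R' ∈ Finset.powersetCard n (Finset.univ : Finset (Fin N)), ((R ∩ R').card.choose (r+1) : ℝ) =
      n.choose (r+1) * (N - (r+1)).choose (n - (r+1)) := by exact_mod_cast h2
  rw [h3]
  have h4 := choose_ratio hn hN (r+1) hr'
  calc ((r:ℝ) + 1) * t ^ r * (n.choose (r+1) * (N - (r+1)).choose (n - (r+1)))
      ≤ ((r:ℝ) + 1) * t ^ r * (n.choose (r+1) * (((n:ℝ) / N) ^ (r+1) * (N.choose n : ℝ))) := by gcongr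
    _ = _ := by rw [mul_pow, pow_succ]; ring

lemma hyper {N n : ℕ} (hn : 0 < n) (hN : n ≤ N) (R : Finset (Fin N)) (hR : R.card = n) {l : ℝ}
    (hl : 0 ≤ l) :
    ∑ R' ∈ Finset.powersetCard n (Finset.univ : Finset (Fin N)),
      ((R ∩ R').card : ℝ) * exp (l * (R ∩ R').card) ≤
      (N.choose n : ℝ) * (((n:ℝ) ^ 2 / N) * exp (l + (exp l - 1) * ((n:ℝ) ^ 2 / N))) := by
  have ht : 0 ≤ exp l - 1 := by linarith [Real.add_one_le_exp l]
  have h := hyper_aux hn hN R hR ht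
  have e : ∀ i : ℕ, (i:ℝ) * exp (l * i) = exp l * ((i:ℝ) * (1 + (exp l - 1)) ^ (i - 1)) := by
    intro i
    rcases i with _ | i
    · simp
    · rw [add_sub_cancel, Nat.add_sub_cancel, ← exp_nat_mul]
      push_cast
      rw [mul_left_comm, ← exp_add]; congr 2; ring
  simp_rw [e]
  rw [← Finset.mul_sum]
  have hN' : (0:ℝ) < N := by exact_mod_cast (lt_of_lt_of_le hn hN)
  have hx : 0 ≤ (exp l - 1) * ((n:ℝ) / N) := by positivity
  have h5 : (1 + (exp l - 1) * ((n:ℝ) / N)) ^ (n - 1) ≤ exp ((exp l - 1) * ((n:ℝ) ^ 2 / N)) := by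
    calc (1 + (exp l - 1) * ((n:ℝ) / N)) ^ (n - 1) ≤ (1 + (exp l - 1) * ((n:ℝ) / N)) ^ n :=
          pow_le_pow_right₀ (by linarith) (by omega)
      _ ≤ exp ((exp l - 1) * ((n:ℝ) / N)) ^ n := by
          gcongr; linarith [Real.add_one_le_exp ((exp l - 1) * ((n:ℝ) / N))]
      _ = _ := by rw [← exp_nat_mul]; congr 1; ring
  calc exp l * _ ≤ exp l * ((N.choose n : ℝ) * (((n:ℝ) / N) * (n * exp ((exp l - 1) * ((n:ℝ) ^ 2 / N))))) := by
        refine mul_le_mul_of_nonneg_left (h.trans ?_) (exp_pos _).le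
        gcongr
    _ = _ := by rw [exp_add]; ring

lemma sum_SIdx {n N : ℕ} (f : Finset (Fin N) × Finset (Fin N) → ℝ) :
    ∑ S : SIdx n N, f S.1 = ∑ R ∈ Finset.powersetCard n (Finset.univ : Finset (Fin N)),
      ∑ C ∈ Finset.powersetCard n (Finset.univ : Finset (Fin N)), f (R, C) := by
  rw [← Finset.sum_product']
  refine Finset.sum_bij (fun S _ => S.1) ?_ ?_ ?_ ?_
  · intro S _
    simp [Finset.mem_powersetCard, S.2.1, S.2.2]
  · intro S _ S' _ h; exact Subtype.ext h
  · intro p hp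
    simp [Finset.mem_powersetCard] at hp
    exact ⟨⟨p, hp⟩, Finset.mem_univ _, rfl⟩
  · intro S _; rfl

lemma card_SIdx (n N : ℕ) : ((Fintype.card (SIdx n N) : ℕ) : ℝ) = (N.choose n : ℝ) ^ 2 := by
  have h := sum_SIdx (n := n) (N := N) (fun _ => 1)
  simp at h
  rw [h, sq]

lemma exp_chord {x y : ℝ} (hx : 0 ≤ x) (hxy : x ≤ y) (hy : 0 < y) :
    exp x - 1 ≤ x / y * (exp y - 1) := by
  have h := convexOn_exp.2 (Set.mem_univ 0) (Set.mem_univ y)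
    (show (0:ℝ) ≤ 1 - x / y by rw [sub_nonneg, div_le_one hy]; exact hxy)
    (show (0:ℝ) ≤ x / y by positivity) (by ring)
  simp only [smul_eq_mul, mul_zero, zero_add, exp_zero, mul_one] at h
  rw [div_mul_cancel₀ _ hy.ne'] at h
  linarith

/-- weighted overlap sum in the region where one overlap is small -/
lemma sum_small {n N : ℕ} (hn : 0 < n) (hN : n ≤ N) (R C : Finset (Fin N)) (hR : R.card = n)
    (hC : C.card = n) {A ε s : ℝ} (hε : 0 < ε)
    (hs : A ^ 2 + ((n:ℝ) ^ 2 / N) * (exp (A ^ 2 * (ε * n)) - 1) / (ε * n) ≤ s)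
    (hs1 : s ≤ 1) (hs2 : s * ((n:ℝ) ^ 2 / N) ≤ 1) (hA : 0 < A) :
    ∑ C' ∈ Finset.powersetCard n (Finset.univ : Finset (Fin N)),
    ∑ R' ∈ Finset.powersetCard n (Finset.univ : Finset (Fin N)),
      (if ((C ∩ C').card : ℝ) ≤ ε * n then
        ((R ∩ R').card : ℝ) * ((C ∩ C').card : ℝ) * exp (A ^ 2 * (((R ∩ R').card : ℝ) * ((C ∩ C').card : ℝ))) else 0) ≤
      (N.choose n : ℝ) ^ 2 * (((n:ℝ) ^ 2 / N) ^ 2 * exp 3) := by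
  set μ : ℝ := (n:ℝ) ^ 2 / N with hμ
  have hμ0 : 0 ≤ μ := by positivity
  have hn' : (0:ℝ) < n := by exact_mod_cast hn
  have hs0 : 0 ≤ s := by
    refine le_trans ?_ hs
    have : 0 ≤ exp (A ^ 2 * (ε * n)) - 1 := by
      have : 0 ≤ A ^ 2 * (ε * n) := by positivity
      linarith [Real.add_one_le_exp (A ^ 2 * (ε * n))]
    positivity
  have hin : ∀ C' ∈ Finset.powersetCard n (Finset.univ : Finset (Fin N)),
      ∑ R' ∈ Finset.powersetCard n (Finset.univ : Finset (Fin N)),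
      (if ((C ∩ C').card : ℝ) ≤ ε * n then
        ((R ∩ R').card : ℝ) * ((C ∩ C').card : ℝ) * exp (A ^ 2 * (((R ∩ R').card : ℝ) * ((C ∩ C').card : ℝ))) else 0)
      ≤ (N.choose n : ℝ) * μ * (((C ∩ C').card : ℝ) * exp (s * (C ∩ C').card)) := by
    intro C' _
    set j : ℝ := ((C ∩ C').card : ℝ) with hj
    have hj0 : 0 ≤ j := by positivity
    by_cases h : j ≤ ε * n
    · simp only [h, if_true]
      have h1 := hyper hn hN R hR (l := A ^ 2 * j) (by positivity)
      have e : ∀ R' : Finset (Fin N), ((R ∩ R').card : ℝ) * j * exp (A ^ 2 * (((R ∩ R').card : ℝ) * j)) =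
          j * (((R ∩ R').card : ℝ) * exp (A ^ 2 * j * (R ∩ R').card)) := by
        intro R'
        rw [show A ^ 2 * (((R ∩ R').card : ℝ) * j) = A ^ 2 * j * (R ∩ R').card by ring]; ring
      simp_rw [e]
      rw [← Finset.mul_sum]
      have hch := exp_chord (x := A ^ 2 * j) (y := A ^ 2 * (ε * n)) (by positivity) (by gcongr) (by positivity)
      have h2 : A ^ 2 * j + (exp (A ^ 2 * j) - 1) * μ ≤ s * j := by
        have e2 : A ^ 2 * j / (A ^ 2 * (ε * n)) = j / (ε * n) := by field_simp
        rw [e2] at hch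
        calc A ^ 2 * j + (exp (A ^ 2 * j) - 1) * μ
            ≤ A ^ 2 * j + (j / (ε * n) * (exp (A ^ 2 * (ε * n)) - 1)) * μ := by gcongr
          _ = (A ^ 2 + μ * (exp (A ^ 2 * (ε * n)) - 1) / (ε * n)) * j := by ring
          _ ≤ s * j := by gcongr
      calc j * _ ≤ j * ((N.choose n : ℝ) * (μ * exp (s * j))) := by
            refine mul_le_mul_of_nonneg_left (h1.trans ?_) hj0
            gcongr
        _ = _ := by ring
    · simp only [h, if_false, Finset.sum_const_zero]
      positivity
  refine (Finset.sum_le_sum hin).trans ?_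
  rw [← Finset.mul_sum]
  have h3 := hyper hn hN C hC hs0
  have h4 : s + (exp s - 1) * μ ≤ 3 := by
    have h5 := exp_chord hs0 hs1 one_pos
    have h6 : exp 1 - 1 ≤ 2 := by linarith [Real.exp_one_lt_d9]
    have h7 : exp s - 1 ≤ 2 * s := by
      rw [div_one] at h5
      nlinarith
    nlinarith
  calc (N.choose n : ℝ) * μ * _ ≤ (N.choose n : ℝ) * μ * ((N.choose n : ℝ) * (μ * exp 3)) := by
        refine mul_le_mul_of_nonneg_left (h3.trans ?_) (by positivity)
        gcongr
    _ = _ := by ring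

lemma sum_large {n N : ℕ} (hn : 0 < n) (hN : n ≤ N) (R C : Finset (Fin N)) (hR : R.card = n)
    (hC : C.card = n) {A θ M : ℝ} (hθ : 0 ≤ θ)
    (hM : exp (2 * (θ + (exp θ - 1) * ((n:ℝ) ^ 2 / N)) - M) ≤ A ^ 2) :
    ∑ R' ∈ Finset.powersetCard n (Finset.univ : Finset (Fin N)),
    ∑ C' ∈ Finset.powersetCard n (Finset.univ : Finset (Fin N)),
      (exp (-M) * (((R ∩ R').card : ℝ) * exp (θ * (R ∩ R').card)) * (((C ∩ C').card : ℝ) * exp (θ * (C ∩ C').card))) ≤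
      (N.choose n : ℝ) ^ 2 * (((n:ℝ) ^ 2 / N) ^ 2 * A ^ 2) := by
  set μ : ℝ := (n:ℝ) ^ 2 / N with hμ
  have hμ0 : 0 ≤ μ := by positivity
  simp_rw [← Finset.mul_sum, ← Finset.sum_mul, ← Finset.mul_sum]
  have h1 := hyper hn hN R hR hθ
  have h2 := hyper hn hN C hC hθ
  calc _ ≤ exp (-M) * ((N.choose n : ℝ) * (μ * exp (θ + (exp θ - 1) * μ))) *
        ((N.choose n : ℝ) * (μ * exp (θ + (exp θ - 1) * μ))) := by
        gcongr
    _ = (N.choose n : ℝ) ^ 2 * (μ ^ 2 * exp (2 * (θ + (exp θ - 1) * μ) - M)) := by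
        generalize θ + (exp θ - 1) * μ = w
        rw [show 2 * w - M = -M + w + w by ring, exp_add, exp_add]; ring
    _ ≤ _ := by gcongr

lemma pair_small_abs (k m : ℝ≥0) {n A z B : ℝ} (hn' : 0 < n) (hA : 0 < A)
    (hA1 : 1 ≤ A ^ 2 * n ^ 2) (hkm : (k:ℝ) + m = n ^ 2) (hB : B = A * n ^ 2 + z * n)
    (hk : (k:ℝ) ≤ n ^ 2 / 2) :
    (∫ x, hT A (n ^ 2) B (x.1 + x.2.1) * hT A (n ^ 2) B (x.1 + x.2.2) ∂(tri k m))
        - stdGaussianCDF z ^ 2 ≤ 3 * A ^ 2 * (k * exp (A ^ 2 * k)) := by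
  have hn2 : 0 < n ^ 2 / 2 := by positivity
  have hm0' : (0:ℝ) < m := by linarith
  have hm0 : m ≠ 0 := by
    intro h; rw [h] at hm0'; exact lt_irrefl _ hm0'
  have h := pair_small hA.le k hm0 n z B hn' hkm hB
  have hPhi1 : stdGaussianCDF z ^ 2 ≤ 1 := pow_le_one₀ (Phi_nonneg _) (Phi_le_one _)
  generalize (∫ x, hT A (n ^ 2) B (x.1 + x.2.1) * hT A (n ^ 2) B (x.1 + x.2.2) ∂(tri k m)) = I at h ⊢
  generalize stdGaussianCDF z ^ 2 = P at h hPhi1 ⊢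
  have hk0 : (0:ℝ) ≤ k := k.2
  generalize (k:ℝ) = k' at *
  generalize (m:ℝ) = m' at *
  have h5 : k' / m' ≤ 2 * A ^ 2 * k' := by
    rw [div_le_iff₀ hm0']
    have : A ^ 2 * m' ≥ A ^ 2 * (n ^ 2 / 2) := by gcongr; linarith
    nlinarith
  have h6 : exp (A ^ 2 * k') - 1 ≤ A ^ 2 * k' * exp (A ^ 2 * k') := by
    have h7 := Real.add_one_le_exp (-(A ^ 2 * k'))
    have h8 : exp (-(A ^ 2 * k')) * exp (A ^ 2 * k') = 1 := by rw [← exp_add]; simp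
    have h9 := mul_le_mul_of_nonneg_right h7 (exp_pos (A ^ 2 * k')).le
    rw [h8] at h9; linarith
  have h10 : 0 ≤ exp (A ^ 2 * k') - 1 := by
    have : 0 ≤ A ^ 2 * k' := by positivity
    linarith [Real.add_one_le_exp (A ^ 2 * k')]
  have h11 : exp (A ^ 2 * k') * (k' / m') ≤ exp (A ^ 2 * k') * (2 * A ^ 2 * k') := by gcongr
  have h12 : (exp (A ^ 2 * k') - 1) * P ≤ (exp (A ^ 2 * k') - 1) * 1 := by gcongr
  linarith

lemma pair_abs (k m : ℝ≥0) {n A z B ε θ M z' i j : ℝ} (hn' : 0 < n) (hA : 0 < A)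
    (hε : 0 < ε) (hε4 : ε ≤ 1 / 2)
    (hA1 : 1 ≤ A ^ 2 * n ^ 2) (hkm : (k:ℝ) + m = n ^ 2) (hB : B = A * n ^ 2 + z * n)
    (hz : z ≤ z') (hz' : 0 ≤ z')
    (hL : ∀ i j : ℝ, ε * n ≤ i → ε * n ≤ j →
      A ^ 2 * n ^ 2 * (i * j) / (n ^ 2 + i * j) + A * n * z' ≤ θ * (i + j) - M)
    (hk : (k:ℝ) = i * j) (hi_le : i ≤ n) (hj_le : j ≤ n)
    (hi_or : 1 ≤ i ∨ i = 0) (hj_or : 1 ≤ j ∨ j = 0) :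
    (∫ x, hT A (n ^ 2) B (x.1 + x.2.1) * hT A (n ^ 2) B (x.1 + x.2.2) ∂(tri k m))
        - stdGaussianCDF z ^ 2 ≤
      3 * A ^ 2 * (if j ≤ ε * n then i * j * exp (A ^ 2 * (i * j)) else 0)
      + 3 * A ^ 2 * (if i ≤ ε * n then j * i * exp (A ^ 2 * (j * i)) else 0)
      + exp (-M) * (i * exp (θ * i)) * (j * exp (θ * j)) := by
  have hi0 : 0 ≤ i := by rcases hi_or with h | h <;> linarith
  have hj0 : 0 ≤ j := by rcases hj_or with h | h <;> linarith
  have t1 : 0 ≤ 3 * A ^ 2 * (if j ≤ ε * n then i * j * exp (A ^ 2 * (i * j)) else 0) := by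
    split_ifs <;> positivity
  have t2 : 0 ≤ 3 * A ^ 2 * (if i ≤ ε * n then j * i * exp (A ^ 2 * (j * i)) else 0) := by
    split_ifs <;> positivity
  have t3 : 0 ≤ exp (-M) * (i * exp (θ * i)) * (j * exp (θ * j)) := by positivity
  have small := fun h => pair_small_abs k m hn' hA hA1 hkm hB h
  have h := pair_chernoff hA.le k m n z B hn' hkm hB z' hz hz'
  have hP := sq_nonneg (stdGaussianCDF z)
  generalize (∫ x, hT A (n ^ 2) B (x.1 + x.2.1) * hT A (n ^ 2) B (x.1 + x.2.2) ∂(tri k m)) = I at h small ⊢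
  generalize stdGaussianCDF z ^ 2 = P at hP small ⊢
  rw [hk] at h small
  by_cases c1 : j ≤ ε * n
  · have hk : i * j ≤ n ^ 2 / 2 := by
      calc i * j ≤ n * (1 / 2 * n) := by gcongr; exact c1.trans (by gcongr)
        _ = _ := by ring
    have := small hk
    rw [if_pos c1]
    linarith
  by_cases c2 : i ≤ ε * n
  · have hk : i * j ≤ n ^ 2 / 2 := by
      calc i * j ≤ (1 / 2 * n) * n := by gcongr; exact c2.trans (by gcongr)
        _ = _ := by ring
    have := small hk
    rw [if_pos c2] at t2 ⊢
    rw [mul_comm j i]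
    linarith
  have h2 := hL i j (le_of_not_ge c2) (le_of_not_ge c1)
  have h3 : exp (θ * (i + j) - M) ≤ exp (-M) * (i * exp (θ * i)) * (j * exp (θ * j)) := by
    have hi1 : 1 ≤ i := by
      rcases hi_or with h | h
      · exact h
      · exfalso; apply c2; rw [h]; positivity
    have hj1 : 1 ≤ j := by
      rcases hj_or with h | h
      · exact h
      · exfalso; apply c1; rw [h]; positivity
    have hij : 1 ≤ i * j := one_le_mul_of_one_le_of_one_le hi1 hj1
    rw [show θ * (i + j) - M = -M + θ * i + θ * j by ring, exp_add, exp_add]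
    calc exp (-M) * exp (θ * i) * exp (θ * j) ≤ (i * j) * (exp (-M) * exp (θ * i) * exp (θ * j)) :=
          le_mul_of_one_le_left (by positivity) hij
      _ = _ := by ring
  have h4 := h.trans ((exp_le_exp.2 h2).trans h3)
  linarith

lemma cast_one_or (a : ℕ) : 1 ≤ (a : ℝ) ∨ (a : ℝ) = 0 := by
  rcases Nat.eq_zero_or_pos a with h | h
  · right; exact_mod_cast h
  · left; exact_mod_cast h

lemma pair_bound {n N : ℕ} (hn : 0 < n) (S S' : SIdx n N) {A ε θ M z z' B : ℝ} (hA : 0 < A)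
    (hε : 0 < ε) (hε4 : ε ≤ 1 / 2) (hA1 : 1 ≤ A ^ 2 * (n:ℝ) ^ 2)
    (hB : B = A * (n:ℝ) ^ 2 + z * n) (hz : z ≤ z') (hz' : 0 ≤ z')
    (hL : ∀ i j : ℝ, ε * n ≤ i → ε * n ≤ j →
      A ^ 2 * (n:ℝ) ^ 2 * (i * j) / ((n:ℝ) ^ 2 + i * j) + A * n * z' ≤ θ * (i + j) - M) :
    (∫ x, hT A ((n:ℝ) ^ 2) B (XS S x) * hT A ((n:ℝ) ^ 2) B (XS S' x) ∂(PTheta N 0)) - stdGaussianCDF z ^ 2 ≤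
      3 * A ^ 2 * (if ((S.1.2 ∩ S'.1.2).card : ℝ) ≤ ε * n then
        ((S.1.1 ∩ S'.1.1).card : ℝ) * ((S.1.2 ∩ S'.1.2).card : ℝ) * exp (A ^ 2 * (((S.1.1 ∩ S'.1.1).card : ℝ) * ((S.1.2 ∩ S'.1.2).card : ℝ))) else 0)
      + 3 * A ^ 2 * (if ((S.1.1 ∩ S'.1.1).card : ℝ) ≤ ε * n then
        ((S.1.2 ∩ S'.1.2).card : ℝ) * ((S.1.1 ∩ S'.1.1).card : ℝ) * exp (A ^ 2 * (((S.1.2 ∩ S'.1.2).card : ℝ) * ((S.1.1 ∩ S'.1.1).card : ℝ))) else 0)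
      + (exp (-M) * (((S.1.1 ∩ S'.1.1).card : ℝ) * exp (θ * (S.1.1 ∩ S'.1.1).card)) * (((S.1.2 ∩ S'.1.2).card : ℝ) * exp (θ * (S.1.2 ∩ S'.1.2).card))) := by
  have hn' : (0:ℝ) < n := by exact_mod_cast hn
  rw [pair_law]
  refine pair_abs _ _ hn' hA hε hε4 hA1 ?_ hB hz hz' hL ?_ ?_ ?_ (cast_one_or _) (cast_one_or _)
  · have := ov_le S S'
    have h : ov S S' + (n ^ 2 - ov S S') = n ^ 2 := by omega
    rw [NNReal.coe_natCast, NNReal.coe_natCast, ← Nat.cast_add, h, Nat.cast_pow]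
  · rw [NNReal.coe_natCast, ov, Nat.cast_mul]
  · exact_mod_cast (Finset.card_le_card Finset.inter_subset_left).trans S.2.1.le
  · exact_mod_cast (Finset.card_le_card Finset.inter_subset_left).trans S.2.2.le

lemma LpiTrunc_eq (n N : ℕ) (A B : ℝ) :
    LpiTrunc n N A B = fun x => (((N.choose n : ℝ)) ^ 2)⁻¹ * ∑ S : SIdx n N, hT A ((n:ℝ) ^ 2) B (XS S x) := by
  funext x
  rfl

lemma XS_measurable {n N : ℕ} (S : SIdx n N) : Measurable (XS S) := by
  rw [XS_eq_XT]; exact XT_measurable _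

lemma mean_eq {n N : ℕ} (hn : 0 < n) (hN : n ≤ N) {A z B : ℝ} (hA : 0 < A)
    (hB : B = A * (n:ℝ) ^ 2 + z * n) :
    ∫ x, LpiTrunc n N A B x ∂(PTheta N 0) = stdGaussianCDF z := by
  have hc : (0:ℝ) < N.choose n := by exact_mod_cast Nat.choose_pos hN
  rw [LpiTrunc_eq]
  rw [integral_const_mul, integral_finsetSum _ fun S _ => hT_integrable hA.le _ _ (XS_measurable S)]
  simp_rw [single_law hn _ z B hB]
  rw [Finset.sum_const, Finset.card_univ, nsmul_eq_mul, card_SIdx]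
  field_simp

lemma var_bound {n N : ℕ} (hn : 0 < n) (hN : n ≤ N) {A ε θ M z z' B s : ℝ} (hA : 0 < A)
    (hε : 0 < ε) (hε4 : ε ≤ 1 / 2) (hA1 : 1 ≤ A ^ 2 * (n:ℝ) ^ 2)
    (hB : B = A * (n:ℝ) ^ 2 + z * n) (hz : z ≤ z') (hz' : 0 ≤ z')
    (hL : ∀ i j : ℝ, ε * n ≤ i → ε * n ≤ j →
      A ^ 2 * (n:ℝ) ^ 2 * (i * j) / ((n:ℝ) ^ 2 + i * j) + A * n * z' ≤ θ * (i + j) - M)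
    (hs : A ^ 2 + ((n:ℝ) ^ 2 / N) * (exp (A ^ 2 * (ε * n)) - 1) / (ε * n) ≤ s)
    (hs1 : s ≤ 1) (hs2 : s * ((n:ℝ) ^ 2 / N) ≤ 1) (hθ : 0 ≤ θ)
    (hM : exp (2 * (θ + (exp θ - 1) * ((n:ℝ) ^ 2 / N)) - M) ≤ A ^ 2) :
    variance (LpiTrunc n N A B) (PTheta N 0) ≤ 200 * A ^ 2 * (n : ℝ) ^ 4 / (N : ℝ) ^ 2 := by
  have hc : (0:ℝ) < N.choose n := by exact_mod_cast Nat.choose_pos hN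
  set μ : ℝ := (n:ℝ) ^ 2 / N with hμ
  set c : ℝ := (N.choose n : ℝ) with hcc
  set q : SIdx n N → SIdx n N → ℝ := fun S S' =>
    ∫ x, hT A ((n:ℝ) ^ 2) B (XS S x) * hT A ((n:ℝ) ^ 2) B (XS S' x) ∂(PTheta N 0) with hq
  have hmeas : Measurable (LpiTrunc n N A B) := by
    rw [LpiTrunc_eq]
    exact (Finset.measurable_sum _ fun S _ => (hT_measurable _ _ _).comp (XS_measurable S)).const_mul _
  have hmem : MemLp (LpiTrunc n N A B) 2 (PTheta N 0) := by
    refine MemLp.of_bound hmeas.aestronglyMeasurable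
      ((c ^ 2)⁻¹ * ∑ S : SIdx n N, exp (A * B - A ^ 2 * (n:ℝ) ^ 2 / 2)) (ae_of_all _ fun x => ?_)
    rw [LpiTrunc_eq, Real.norm_of_nonneg]
    · exact mul_le_mul_of_nonneg_left (Finset.sum_le_sum fun S _ => hT_le hA.le _ _ _) (by positivity)
    · exact mul_nonneg (by positivity) (Finset.sum_nonneg fun S _ => hT_nonneg _ _ _ _)
  rw [variance_eq_sub hmem, mean_eq hn hN hA hB]
  have hsq : ∫ x, (LpiTrunc n N A B ^ 2) x ∂(PTheta N 0) = (c ^ 2)⁻¹ ^ 2 * ∑ S : SIdx n N, ∑ S' : SIdx n N, q S S' := by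
    have e : ∀ x, (LpiTrunc n N A B ^ 2) x = (c ^ 2)⁻¹ ^ 2 *
        ∑ S : SIdx n N, ∑ S' : SIdx n N, hT A ((n:ℝ) ^ 2) B (XS S x) * hT A ((n:ℝ) ^ 2) B (XS S' x) := by
      intro x
      rw [Pi.pow_apply, LpiTrunc_eq, mul_pow, sq (∑ S : SIdx n N, _), Finset.sum_mul_sum]
    simp_rw [e]
    have hi : ∀ S S' : SIdx n N, Integrable (fun x => hT A ((n:ℝ) ^ 2) B (XS S x) * hT A ((n:ℝ) ^ 2) B (XS S' x)) (PTheta N 0) :=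
      fun S S' => hT_mul_integrable hA.le _ _ (XS_measurable S) (XS_measurable S')
    rw [integral_const_mul, integral_finsetSum _ fun S _ => integrable_finsetSum _ fun S' _ => hi S S']
    congr 1
    refine Finset.sum_congr rfl fun S _ => ?_
    rw [integral_finsetSum _ fun S' _ => hi S S']
  have hconst : ∑ S : SIdx n N, ∑ S' : SIdx n N, stdGaussianCDF z ^ 2 = c ^ 2 * (c ^ 2 * stdGaussianCDF z ^ 2) := by
    simp only [Finset.sum_const, Finset.card_univ, nsmul_eq_mul, card_SIdx]; rw [hcc]
  have hrow : ∀ S : SIdx n N, ∑ S' : SIdx n N, (q S S' - stdGaussianCDF z ^ 2) ≤ c ^ 2 * (200 * A ^ 2 * μ ^ 2) := by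
    intro S
    refine (Finset.sum_le_sum fun S' _ => pair_bound hn S S' hA hε hε4 hA1 hB hz hz' hL).trans ?_
    rw [Finset.sum_add_distrib, Finset.sum_add_distrib, ← Finset.mul_sum, ← Finset.mul_sum]
    have b1 := sum_small hn hN S.1.1 S.1.2 S.2.1 S.2.2 hε hs hs1 hs2 hA
    have b2 := sum_small hn hN S.1.2 S.1.1 S.2.2 S.2.1 hε hs hs1 hs2 hA
    have b3 := sum_large hn hN S.1.1 S.1.2 S.2.1 S.2.2 hθ hM
    rw [Finset.sum_comm] at b1
    rw [← sum_SIdx (fun p => (if ((S.1.2 ∩ p.2).card : ℝ) ≤ ε * n then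
        ((S.1.1 ∩ p.1).card : ℝ) * ((S.1.2 ∩ p.2).card : ℝ) * exp (A ^ 2 * (((S.1.1 ∩ p.1).card : ℝ) * ((S.1.2 ∩ p.2).card : ℝ))) else 0))] at b1
    rw [← sum_SIdx (fun p => (if ((S.1.1 ∩ p.1).card : ℝ) ≤ ε * n then
        ((S.1.2 ∩ p.2).card : ℝ) * ((S.1.1 ∩ p.1).card : ℝ) * exp (A ^ 2 * (((S.1.2 ∩ p.2).card : ℝ) * ((S.1.1 ∩ p.1).card : ℝ))) else 0))] at b2
    rw [← sum_SIdx (fun p => (exp (-M) * (((S.1.1 ∩ p.1).card : ℝ) * exp (θ * (S.1.1 ∩ p.1).card)) * (((S.1.2 ∩ p.2).card : ℝ) * exp (θ * (S.1.2 ∩ p.2).card))))] at b3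
    have he3 : exp 3 ≤ 33 := by
      have h1 := Real.exp_one_lt_d9
      have : exp 3 = exp 1 ^ 3 := by rw [← exp_nat_mul]; norm_num
      rw [this]
      calc exp 1 ^ 3 ≤ 2.7182818286 ^ 3 := by gcongr
        _ ≤ 33 := by norm_num
    have hA2 : 0 ≤ 3 * A ^ 2 := by positivity
    have b1' := mul_le_mul_of_nonneg_left b1 hA2
    have b2' := mul_le_mul_of_nonneg_left b2 hA2
    have hX : 0 ≤ A ^ 2 * (c ^ 2 * μ ^ 2) := by positivity
    have : A ^ 2 * (c ^ 2 * μ ^ 2) * exp 3 ≤ A ^ 2 * (c ^ 2 * μ ^ 2) * 33 := by gcongr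
    refine (add_le_add (add_le_add b1' b2') b3).trans ?_
    rw [← hcc, ← hμ]
    nlinarith
  have htot : ∑ S : SIdx n N, ∑ S' : SIdx n N, (q S S' - stdGaussianCDF z ^ 2) ≤ c ^ 2 * (c ^ 2 * (200 * A ^ 2 * μ ^ 2)) := by
    refine (Finset.sum_le_sum fun S _ => hrow S).trans (le_of_eq ?_)
    simp only [Finset.sum_const, Finset.card_univ, nsmul_eq_mul, card_SIdx]; rw [hcc]
  simp_rw [Finset.sum_sub_distrib] at htot
  rw [hconst] at htot
  rw [hsq]
  have hfin : (c ^ 2)⁻¹ ^ 2 * (∑ S : SIdx n N, ∑ S' : SIdx n N, q S S') ≤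
      (c ^ 2)⁻¹ ^ 2 * (c ^ 2 * (c ^ 2 * (200 * A ^ 2 * μ ^ 2)) + c ^ 2 * (c ^ 2 * stdGaussianCDF z ^ 2)) := by
    gcongr; linarith
  have e5 : (c ^ 2)⁻¹ ^ 2 * (c ^ 2 * (c ^ 2 * (200 * A ^ 2 * μ ^ 2)) + c ^ 2 * (c ^ 2 * stdGaussianCDF z ^ 2)) = 200 * A ^ 2 * μ ^ 2 + stdGaussianCDF z ^ 2 := by
    field_simp
  have e6 : 200 * A ^ 2 * (n : ℝ) ^ 4 / (N : ℝ) ^ 2 = 200 * A ^ 2 * μ ^ 2 := by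
    rw [hμ, div_pow]; ring
  rw [e6]
  linarith

lemma log_mul_rpow_tendsto {c : ℝ} (hc : 0 < c) :
    Tendsto (fun x : ℝ => log x * x ^ (-c)) atTop (𝓝 0) := by
  have h := (isLittleO_log_rpow_atTop hc).tendsto_div_nhds_zero
  refine h.congr' ?_
  filter_upwards [eventually_gt_atTop (0:ℝ)] with x hx
  rw [rpow_neg hx.le, div_eq_mul_inv]

lemma eventual_facts {α δ ε : ℝ} (hα : 1 / 2 < α) (hδ : -1 < δ) (hδ0 : δ < 0) (hε : 0 < ε) :
    ∀ᶠ x : ℝ in atTop, 2 ≤ x ∧ 1 ≤ 4 * (1 + δ) * α * log x ∧ 16 * α * (log x * x ^ (1 - 2 * α)) < 1 ∧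
      4 * α * log x / x + 2 / ε * x ^ (-(1 / 2) : ℝ) ≤ 1 ∧
      8 * α * (log x * x ^ (-α)) + 4 / ε * x ^ (1 / 2 - α) ≤ 1 ∧
      2 * α * log x + 4 * x + √(4 * α * x * log x) * (1 / 2 + α * log x) - (-δ) * α * ε * x * log x ≤ - log x := by
  have hα0 : 0 < α := by linarith
  have f1 := eventually_ge_atTop (2:ℝ)
  have f2 := (tendsto_log_atTop.const_mul_atTop (show 0 < 4 * (1 + δ) * α by
    have : 0 < 1 + δ := by linarith
    positivity)).eventually_ge_atTop 1
  have f3 := ((log_mul_rpow_tendsto (c := 2 * α - 1) (by linarith)).const_mul (16 * α)).eventually_lt_const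
    (show 16 * α * 0 < 1 by simp)
  have f4 := (((log_mul_rpow_tendsto (c := 1) one_pos).const_mul (4 * α)).add
    ((tendsto_rpow_neg_atTop (y := 1 / 2) (by norm_num)).const_mul (2 / ε))).eventually_lt_const
    (show 4 * α * 0 + 2 / ε * 0 < 1 by simp)
  have f5 := (((log_mul_rpow_tendsto (c := α) hα0).const_mul (8 * α)).add
    ((tendsto_rpow_neg_atTop (y := α - 1 / 2) (by linarith)).const_mul (4 / ε))).eventually_lt_const
    (show 8 * α * 0 + 4 / ε * 0 < 1 by simp)
  set K : ℝ := (2 * α + 1 + 4 + √(4 * α) * (1 / 2 + α)) / ((-δ) * α * ε) with hK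
  have f6 := tendsto_log_atTop.eventually_ge_atTop (max 1 K)
  have f7 : ∀ᶠ x : ℝ in atTop, log x ^ 3 ≤ x := by
    have := (isLittleO_pow_log_id_atTop (n := 3)).bound one_pos
    filter_upwards [this, eventually_gt_atTop (0:ℝ)] with x hx h0
    rw [one_mul] at hx
    simp only [id, Real.norm_eq_abs, abs_of_pos h0] at hx
    exact (le_abs_self _).trans hx
  filter_upwards [f1, f2, f3, f4, f5, f6, f7] with x h1 h2 h3 h4 h5 h6 h7
  have hx0 : 0 < x := by linarith
  refine ⟨h1, h2, ?_, ?_, ?_, ?_⟩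
  · rwa [show 1 - 2 * α = -(2 * α - 1) by ring]
  · rw [rpow_neg_one] at h4
    have : 4 * α * log x / x = 4 * α * (log x * x⁻¹) := by ring
    rw [this]; exact h4.le
  · rw [show 1 / 2 - α = -(α - 1 / 2) by ring]; exact h5.le
  · have hL1 : 1 ≤ log x := (le_max_left _ _).trans h6
    have hLK : K ≤ log x := (le_max_right _ _).trans h6
    set L := log x with hL
    have hLx : L ≤ x := by nlinarith [sq_nonneg (L - 1), sq_nonneg L]
    have hd : 0 < (-δ) * α * ε := by
      have : 0 < -δ := by linarith
      positivity
    rw [hK, div_le_iff₀ hd] at hLK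
    have hs : √(4 * α * x * L) * L ≤ √(4 * α) * x := by
      rw [show 4 * α * x * L = 4 * α * (x * L) by ring, sqrt_mul (by positivity)]
      have : √(x * L) * L ≤ x := by
        have e : √(x * L) * L = √(x * L ^ 3) := by
          rw [show x * L ^ 3 = (x * L) * L ^ 2 by ring, sqrt_mul (show 0 ≤ x * L by positivity) (L ^ 2),
            sqrt_sq (show 0 ≤ L by linarith)]
        rw [e]
        calc √(x * L ^ 3) ≤ √(x * x) := by gcongr
          _ = x := sqrt_mul_self hx0.le
      calc √(4 * α) * √(x * L) * L = √(4 * α) * (√(x * L) * L) := by ring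
        _ ≤ _ := by gcongr
    have hs2 : √(4 * α * x * L) * (1 / 2 + α * L) ≤ √(4 * α) * x * (1 / 2 + α) := by
      calc √(4 * α * x * L) * (1 / 2 + α * L) ≤ √(4 * α * x * L) * (1 / 2 * L + α * L) := by
            gcongr; linarith
        _ = (√(4 * α * x * L) * L) * (1 / 2 + α) := by ring
        _ ≤ _ := by gcongr
    have h8 := mul_le_mul_of_nonneg_right hLK hx0.le
    nlinarith

lemma ratio_ineq {n i j : ℝ} (hn : 0 < n) (hi : 0 ≤ i) (hj : 0 ≤ j) :
    4 * n * (i * j) / (n ^ 2 + i * j) ≤ i + j := by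
  rw [div_le_iff₀ (by positivity)]
  nlinarith [mul_nonneg hi (sq_nonneg (n - j)), mul_nonneg hj (sq_nonneg (n - i))]

set_option maxHeartbeats 1000000 in
lemma core {α δ : ℝ} (hα : 1 / 2 < α) (hδ : -1 < δ) (hδ0 : δ < 0) {ε : ℝ} (hεd : ε = (2 * α - 1) / (8 * α))
    {n : ℕ} (h2 : 2 ≤ (n:ℝ)) (hA2 : 1 ≤ 4 * (1 + δ) * α * log n)
    (hp : 16 * α * (log n * (n:ℝ) ^ (1 - 2 * α)) < 1)
    (hs1 : 4 * α * log n / n + 2 / ε * (n:ℝ) ^ (-(1 / 2) : ℝ) ≤ 1)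
    (hs2 : 8 * α * (log n * (n:ℝ) ^ (-α)) + 4 / ε * (n:ℝ) ^ (1 / 2 - α) ≤ 1)
    (hM : 2 * α * log n + 4 * n + √(4 * α * n * log n) * (1 / 2 + α * log n) - (-δ) * α * ε * n * log n ≤ - log n)
    {N : ℕ} {A B : ℝ} (hN : N = ⌊(n : ℝ) ^ (1 + α)⌋₊)
    (hA : A = Real.sqrt (4 * (1 + δ) * α * Real.log n / n))
    (hB : B = A * (n : ℝ) ^ 2 + stdGaussianInvCDF (1 - A * (n : ℝ) ^ 2 / N) * n) :
    (∫ x, LpiTrunc n N A B x ∂(PTheta N 0)) = 1 - A * (n : ℝ) ^ 2 / N ∧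
        variance (LpiTrunc n N A B) (PTheta N 0) ≤ 200 * A ^ 2 * (n : ℝ) ^ 4 / (N : ℝ) ^ 2 := by
  have hα0 : 0 < α := by linarith
  have hε : 0 < ε := by rw [hεd]; apply div_pos <;> linarith
  have hε4 : ε ≤ 1 / 2 := by rw [hεd, div_le_div_iff₀ (by positivity) (by norm_num)]; linarith
  have hεα : 4 * α * ε = (2 * α - 1) / 2 := by rw [hεd]; field_simp; ring
  have h1δ : 0 < 1 + δ := by linarith
  have hx0 : (0:ℝ) < n := by linarith
  have hn : 0 < n := by exact_mod_cast hx0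
  have hx1 : (1:ℝ) ≤ n := by linarith
  have hL0 : 0 < log (n:ℝ) := log_pos (by linarith)
  have hnN : n ≤ N := by
    rw [hN]; apply Nat.le_floor
    calc (n:ℝ) = (n:ℝ) ^ (1:ℝ) := (rpow_one _).symm
      _ ≤ _ := rpow_le_rpow_of_exponent_le hx1 (by linarith)
  have hN0 : (0:ℝ) < N := by exact_mod_cast hn.trans_le hnN
  have hNup : (N:ℝ) ≤ (n:ℝ) ^ (1 + α) := by rw [hN]; exact Nat.floor_le (by positivity)
  have hNlo : (n:ℝ) ^ (1 + α) / 2 ≤ N := by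
    have h := Nat.lt_floor_add_one ((n:ℝ) ^ (1 + α))
    rw [← hN] at h
    have : (n:ℝ) ≤ N := by exact_mod_cast hnN
    linarith
  have hpow : (n:ℝ) ^ 2 = (n:ℝ) ^ (1 - α) * (n:ℝ) ^ (1 + α) := by
    rw [← rpow_add hx0, show 1 - α + (1 + α) = ((2:ℕ):ℝ) by push_cast; ring, rpow_natCast]
  have hμ : (n:ℝ) ^ 2 / N ≤ 2 * (n:ℝ) ^ (1 - α) := by
    rw [div_le_iff₀ hN0, hpow]
    have : 0 ≤ (n:ℝ) ^ (1 - α) := by positivity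
    nlinarith
  set L := log (n:ℝ) with hL
  have hAsq : A ^ 2 = 4 * (1 + δ) * α * L / n := by rw [hA, sq_sqrt (by positivity)]
  have hApos : 0 < A := by rw [hA]; apply sqrt_pos.2; positivity
  have hAn : A ^ 2 * n = 4 * (1 + δ) * α * L := by rw [hAsq]; field_simp
  have hAub : A ^ 2 ≤ 4 * α * L / n := by
    rw [hAsq]; gcongr
    nlinarith [mul_pos hα0 hL0]
  have hA1n : 1 / (n:ℝ) ≤ A ^ 2 := by rw [div_le_iff₀ hx0, hAn]; exact hA2
  have hp0 : 0 < A * (n : ℝ) ^ 2 / N := by positivity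
  have hp1 : A * (n : ℝ) ^ 2 / N < 1 := by
    have : (A * (n : ℝ) ^ 2 / N) ^ 2 < 1 := by
      rw [mul_div_assoc, mul_pow]
      calc A ^ 2 * ((n:ℝ) ^ 2 / N) ^ 2 ≤ (4 * α * L / n) * (2 * (n:ℝ) ^ (1 - α)) ^ 2 := by gcongr
        _ = 16 * α * (L * ((n:ℝ) ^ (-1:ℝ) * ((n:ℝ) ^ (1 - α)) ^ 2)) := by rw [rpow_neg_one]; ring
        _ = 16 * α * (L * (n:ℝ) ^ (1 - 2 * α)) := by
          rw [← rpow_natCast, ← rpow_mul hx0.le, ← rpow_add hx0]; congr 3; push_cast; ring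
        _ < 1 := hp
    nlinarith
  set p := A * (n : ℝ) ^ 2 / N with hpdef
  set z := stdGaussianInvCDF (1 - p) with hz
  have hPz : stdGaussianCDF z = 1 - p := Phi_inv (by linarith) (by linarith)
  refine ⟨by rw [mean_eq hn hnN hApos hB, hPz], ?_⟩
  have hzle : z ≤ 1 / 2 + α * L := by
    have h := Phi_tail z
    rw [hPz] at h
    have h3 : (n:ℝ) ^ (-α) ≤ p := by
      have hA' : (n:ℝ) ^ (-(1/2):ℝ) ≤ A := by
        refine (pow_le_pow_iff_left₀ (by positivity) hApos.le two_ne_zero).1 ?_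
        rw [← rpow_natCast, ← rpow_mul hx0.le]
        have : (-(1/2):ℝ) * ((2:ℕ):ℝ) = -1 := by norm_num
        rw [this, rpow_neg_one, ← one_div]; exact hA1n
      have h5 : (n:ℝ) ^ (1 - α) ≤ (n:ℝ) ^ 2 / N := by
        rw [le_div_iff₀ hN0, hpow]; gcongr
      calc (n:ℝ) ^ (-α) ≤ (n:ℝ) ^ (-(1/2) + (1 - α)) := rpow_le_rpow_of_exponent_le hx1 (by linarith)
        _ = (n:ℝ) ^ (-(1/2):ℝ) * (n:ℝ) ^ (1 - α) := rpow_add hx0 _ _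
        _ ≤ A * ((n:ℝ) ^ 2 / N) := by gcongr
        _ = p := by rw [hpdef]; ring
    rw [rpow_def_of_pos hx0] at h3
    have h4 : exp (log (n:ℝ) * -α) ≤ exp (1 / 2 - z) := by linarith
    rw [exp_le_exp] at h4
    rw [← hL] at h4; linarith
  have hAnle : A * n ≤ √(4 * α * n * L) := by
    apply le_sqrt_of_sq_le
    have : (A * n) ^ 2 = A ^ 2 * n * n := by ring
    rw [this, hAn]
    have h7 := mul_pos (mul_pos hα0 hL0) hx0
    have h8 : δ * (α * L * n) ≤ 0 := mul_nonpos_of_nonpos_of_nonneg hδ0.le h7.le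
    linarith
  refine var_bound hn hnN (ε := ε) (θ := (1 + δ / 2) * α * L)
    (M := (-δ) * α * ε * n * L - A * n * (1 / 2 + α * L)) (z := z) (z' := 1 / 2 + α * L)
    (s := 4 * α * L / n + 2 / ε * (n:ℝ) ^ (-(1 / 2) : ℝ)) hApos hε hε4 ?_ hB hzle (by positivity) ?_ ?_ hs1 ?_ ?_ ?_
  · have : A ^ 2 * (n:ℝ) ^ 2 = A ^ 2 * n * n := by ring
    rw [this, hAn]
    nlinarith
  · intro i j hi hj
    have hεn : 0 ≤ ε * n := by positivity
    have hr := ratio_ineq hx0 (hεn.trans hi) (hεn.trans hj)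
    have e : A ^ 2 * (n:ℝ) ^ 2 * (i * j) / ((n:ℝ) ^ 2 + i * j) =
        (1 + δ) * α * L * (4 * n * (i * j) / ((n:ℝ) ^ 2 + i * j)) := by
      rw [show A ^ 2 * (n:ℝ) ^ 2 = (A ^ 2 * n) * n by ring, hAn]; ring
    have h5 : (1 + δ) * α * L * (4 * n * (i * j) / ((n:ℝ) ^ 2 + i * j)) ≤ (1 + δ) * α * L * (i + j) := by
      gcongr
    have h6 : (-δ) * α * L * (2 * (ε * n)) ≤ (-δ) * α * L * (i + j) := by
      have : 0 ≤ -δ := by linarith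
      gcongr; linarith
    rw [e]
    linarith
  · have h3 : exp (A ^ 2 * (ε * n)) ≤ (n:ℝ) ^ (α - 1 / 2) := by
      rw [rpow_def_of_pos hx0, ← hL]
      apply exp_le_exp.2
      have : A ^ 2 * (ε * n) = (1 + δ) * L * (4 * α * ε) := by
        rw [show A ^ 2 * (ε * n) = (A ^ 2 * n) * ε by ring, hAn]; ring
      rw [this, hεα]
      have : 0 < L * (2 * α - 1) := mul_pos hL0 (by linarith)
      nlinarith
    have h4 : ((n:ℝ) ^ 2 / N) * (exp (A ^ 2 * (ε * n)) - 1) / (ε * n) ≤ 2 / ε * (n:ℝ) ^ (-(1 / 2) : ℝ) := by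
      calc ((n:ℝ) ^ 2 / N) * (exp (A ^ 2 * (ε * n)) - 1) / (ε * n)
          ≤ (2 * (n:ℝ) ^ (1 - α)) * (n:ℝ) ^ (α - 1 / 2) / (ε * n) := by
            have : exp (A ^ 2 * (ε * n)) - 1 ≤ (n:ℝ) ^ (α - 1 / 2) := by linarith
            have h0 : 0 ≤ exp (A ^ 2 * (ε * n)) - 1 := by
              rw [sub_nonneg]; exact one_le_exp (by positivity)
            gcongr
        _ = 2 / ε * ((n:ℝ) ^ (1 - α) * (n:ℝ) ^ (α - 1 / 2) * (n:ℝ) ^ (-1:ℝ)) := by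
            rw [rpow_neg_one]; field_simp
        _ = _ := by rw [← rpow_add hx0, ← rpow_add hx0]; congr 2; ring
    linarith
  · refine le_trans ?_ hs2
    calc (4 * α * L / n + 2 / ε * (n:ℝ) ^ (-(1 / 2) : ℝ)) * ((n:ℝ) ^ 2 / N)
        ≤ (4 * α * L / n + 2 / ε * (n:ℝ) ^ (-(1 / 2) : ℝ)) * (2 * (n:ℝ) ^ (1 - α)) := by gcongr
      _ = 8 * α * (L * ((n:ℝ) ^ (-1:ℝ) * (n:ℝ) ^ (1 - α))) +
          4 / ε * ((n:ℝ) ^ (-(1 / 2) : ℝ) * (n:ℝ) ^ (1 - α)) := by rw [rpow_neg_one]; ring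
      _ = _ := by
        rw [← rpow_add hx0, ← rpow_add hx0, show -1 + (1 - α) = -α by ring,
          show -(1 / 2) + (1 - α) = 1 / 2 - α by ring]
  · have : 0 < 1 + δ / 2 := by linarith
    positivity
  · have hlow : exp (-L) ≤ A ^ 2 := by
      rw [exp_neg, hL, exp_log hx0, ← one_div]; exact hA1n
    refine le_trans (exp_le_exp.2 ?_) hlow
    have h3 : (exp ((1 + δ / 2) * α * L) - 1) * ((n:ℝ) ^ 2 / N) ≤ 2 * n := by
      calc (exp ((1 + δ / 2) * α * L) - 1) * ((n:ℝ) ^ 2 / N)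
          ≤ (n:ℝ) ^ α * (2 * (n:ℝ) ^ (1 - α)) := by
            have : exp ((1 + δ / 2) * α * L) - 1 ≤ (n:ℝ) ^ α := by
              rw [rpow_def_of_pos hx0, ← hL]
              have : exp ((1 + δ / 2) * α * L) ≤ exp (L * α) := by
                apply exp_le_exp.2
                nlinarith [mul_pos hα0 hL0]
              linarith
            gcongr
        _ = 2 * ((n:ℝ) ^ α * (n:ℝ) ^ (1 - α)) := by ring
        _ = 2 * n := by rw [← rpow_add hx0, show α + (1 - α) = 1 by ring, rpow_one]
    have h4 : A * n * (1 / 2 + α * L) ≤ √(4 * α * n * L) * (1 / 2 + α * L) := by gcongr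
    have h5 : (1 + δ / 2) * α * L ≤ α * L := by nlinarith [mul_pos hα0 hL0]
    linarith

/-- **Moments of the truncated likelihood ratio in the sparse below-boundary regime.**
Fix α > 1/2 and δ ∈ (−1, 0).  With `N = ⌊n^{1+α}⌋`, `A = √(4(1+δ)α log n / n)` and
truncation level `B = A n² + Φ⁻¹(1 − A n²/N) n`, there are an absolute constant C < ∞
and a threshold n₁(α, δ) such that for all n ≥ n₁:
`E₀(L'_π) = 1 − A n²/N` and `Var₀(L'_π) ≤ C A² n⁴ / N²`. -/
theorem truncated_likelihood_moments_sparse_below :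
    ∃ C : ℝ, 0 < C ∧ ∀ α δ : ℝ, 1 / 2 < α → -1 < δ → δ < 0 →
      ∃ n₁ : ℕ, ∀ n : ℕ, n₁ ≤ n → ∀ (N : ℕ) (A B : ℝ),
        N = ⌊(n : ℝ) ^ (1 + α)⌋₊ →
        A = Real.sqrt (4 * (1 + δ) * α * Real.log n / n) →
        B = A * (n : ℝ) ^ 2 + stdGaussianInvCDF (1 - A * (n : ℝ) ^ 2 / N) * n →
        (∫ x, LpiTrunc n N A B x ∂(PTheta N 0)) = 1 - A * (n : ℝ) ^ 2 / N ∧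
        variance (LpiTrunc n N A B) (PTheta N 0) ≤ C * A ^ 2 * (n : ℝ) ^ 4 / (N : ℝ) ^ 2 := by
  refine ⟨200, by norm_num, fun α δ hα hδ hδ0 => ?_⟩
  have hε : 0 < (2 * α - 1) / (8 * α) := by apply div_pos <;> linarith
  obtain ⟨n₁, h⟩ := eventually_atTop.1
    (tendsto_natCast_atTop_atTop.eventually (eventual_facts hα hδ hδ0 hε))
  refine ⟨n₁, fun n hn N A B hN hA hB => ?_⟩
  obtain ⟨g1, g2, g3, g4, g5, g6⟩ := h n hn
  exact core hα hδ hδ0 rfl g1 g2 g3 g4 g5 g6 hN hA hB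

end
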